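/- arXiv:0806.3442 — 2 statements merged into one kernel-verified Lean document; each statement's English description precedes it below -/
import Mathlib

section
/- Let N ≥ 1 and let x_1, …, x_N ∈ ℝ³ be unit vectors such that x_k × x_av = 0 for every k, where x_av = (1/N) ∑_{j=1}^N x_j, and suppose x_av ≠ 0. Then, with a = x_av / ‖x_av‖, every x_k equals either a or −a, and if M denotes the number of indices k with x_k = −a, then 0 ≤ M ≤ (N−1)/2 and ‖x_av‖ = (N − 2M)/N; in particular ‖x_av‖ ≥ 1/N. -/
noncomputable section

/-- Euclidean norm on `ℝ³` (represented as `Fin 3 → ℝ`). -/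
def norm3 (v : Fin 3 → ℝ) : ℝ := Real.sqrt (∑ i, v i ^ 2)

/-- The cross product on `ℝ³`. -/
def cross3 (u v : Fin 3 → ℝ) : Fin 3 → ℝ := crossProduct u v

theorem norm3_sq (v : Fin 3 → ℝ) : norm3 v ^ 2 = v 0 ^ 2 + v 1 ^ 2 + v 2 ^ 2 := by
  rw [norm3, Real.sq_sqrt (Finset.sum_nonneg fun i _ => sq_nonneg (v i)), Fin.sum_univ_three]

theorem norm3_nonneg (v : Fin 3 → ℝ) : 0 ≤ norm3 v := Real.sqrt_nonneg _

theorem norm3_pos {v : Fin 3 → ℝ} (hv : v ≠ 0) : 0 < norm3 v := by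
  refine lt_of_le_of_ne (norm3_nonneg v) fun h => hv ?_
  have hsq := norm3_sq v
  rw [← h] at hsq
  ext i
  have : v i ^ 2 = 0 := by
    fin_cases i <;> simp <;> nlinarith [sq_nonneg (v 0), sq_nonneg (v 1), sq_nonneg (v 2)]
  simpa using this

theorem norm3_smul (c : ℝ) (v : Fin 3 → ℝ) : norm3 (c • v) = |c| * norm3 v := by
  rw [← abs_of_nonneg (norm3_nonneg (c • v)), ← abs_of_nonneg (norm3_nonneg v), ← abs_mul,
    ← sq_eq_sq_iff_abs_eq_abs, mul_pow, norm3_sq, norm3_sq]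
  simp only [Pi.smul_apply, smul_eq_mul]
  ring

theorem cross3_smul_right (c : ℝ) (u v : Fin 3 → ℝ) : cross3 u (c • v) = c • cross3 u v := by
  simp [cross3]

/-- Two parallel unit vectors agree up to sign. -/
theorem eq_or_eq_neg_of_cross3_eq_zero {u a : Fin 3 → ℝ} (hu : norm3 u = 1) (ha : norm3 a = 1)
    (h : cross3 u a = 0) : u = a ∨ u = -a := by
  have ha' := norm3_sq a
  rw [ha] at ha'
  rw [cross3, cross_apply] at h
  have h0 : u 1 * a 2 - u 2 * a 1 = 0 := by simpa using congrFun h 0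
  have h1 : u 2 * a 0 - u 0 * a 2 = 0 := by simpa using congrFun h 1
  have h2 : u 0 * a 1 - u 1 * a 0 = 0 := by simpa using congrFun h 2
  obtain ⟨d, hd⟩ : ∃ d, d = u 0 * a 0 + u 1 * a 1 + u 2 * a 2 := ⟨_, rfl⟩
  have e : u = d • a := by
    ext i
    fin_cases i <;> simp [hd]
    · linear_combination u 0 * ha' - a 2 * h1 + a 1 * h2
    · linear_combination u 1 * ha' + a 2 * h0 - a 0 * h2
    · linear_combination u 2 * ha' - a 1 * h0 + a 0 * h1
  have hd1 : |d| = 1 := by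
    rw [← hu, e, norm3_smul, ha, mul_one]
  rcases eq_or_eq_neg_of_abs_eq hd1 with h | h
  · left; rw [e, h, one_smul]
  · right; rw [e, h, neg_one_smul]

/-- A sum of vectors each equal to `a` or `-a` is `a` times the number of terms minus twice the
number of terms equal to `-a`. -/
theorem sum_eq_smul_of_eq_or_eq_neg {ι E : Type*} [Fintype ι] [AddCommGroup E] [Module ℝ E]
    [DecidableEq E] {x : ι → E} {a : E} (h : ∀ k, x k = a ∨ x k = -a) :
    ∑ k, x k =
      ((Fintype.card ι : ℝ) - 2 * (Finset.univ.filter fun k => x k = -a).card) • a := by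
  have hx : ∀ k, x k = ((1 : ℝ) - 2 * if x k = -a then 1 else 0) • a := by
    intro k
    split_ifs with hk
    · rw [hk]; module
    · rw [(h k).resolve_right hk]; module
  rw [Finset.sum_congr rfl fun k _ => hx k, ← Finset.sum_smul, Finset.sum_sub_distrib,
    ← Finset.mul_sum, Finset.sum_boole]
  simp

/-- If unit vectors `x_1, …, x_N` satisfy `x_k × x_av = 0` for all `k` and
`x_av ≠ 0`, then with `a = x_av / ‖x_av‖` every `x_k` is `a` or `−a`; if `M` is the number of
anti-aligned vectors then `0 ≤ M ≤ (N − 1)/2`, `‖x_av‖ = (N − 2M)/N`, and `‖x_av‖ ≥ 1/N`. -/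
theorem critical_points_of_synchrony_potential
    (N : ℕ) (hN : 1 ≤ N)
    (x : Fin N → Fin 3 → ℝ)
    (hunit : ∀ k, norm3 (x k) = 1)
    (xav : Fin 3 → ℝ) (hav : xav = (N : ℝ)⁻¹ • ∑ j, x j)
    (hcrit : ∀ k, cross3 (x k) xav = 0)
    (hne : xav ≠ 0) :
    ∀ a : Fin 3 → ℝ, a = (norm3 xav)⁻¹ • xav →
      (∀ k, x k = a ∨ x k = -a) ∧
      (∀ M : ℕ, M = (Finset.univ.filter fun k => x k = -a).card →
        (M : ℝ) ≤ ((N : ℝ) - 1) / 2 ∧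
        norm3 xav = ((N : ℝ) - 2 * M) / N ∧
        1 / (N : ℝ) ≤ norm3 xav) := by
  intro a ha
  have hr := norm3_pos hne
  have hNpos : (0 : ℝ) < N := by exact_mod_cast hN
  have hua : norm3 a = 1 := by
    rw [ha, norm3_smul, abs_of_pos (inv_pos.mpr hr), inv_mul_cancel₀ hr.ne']
  have hsign : ∀ k, x k = a ∨ x k = -a := fun k =>
    eq_or_eq_neg_of_cross3_eq_zero (hunit k) hua (by rw [ha, cross3_smul_right, hcrit, smul_zero])
  refine ⟨hsign, fun M hM => ?_⟩
  have ha0 : a ≠ 0 := by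
    rintro rfl
    simp [norm3] at hua
  have hsum := sum_eq_smul_of_eq_or_eq_neg hsign
  rw [Fintype.card_fin, ← hM] at hsum
  have hxa : xav = norm3 xav • a := by rw [ha, smul_inv_smul₀ hr.ne']
  have hnorm : norm3 xav = ((N : ℝ) - 2 * M) / N := by
    apply smul_left_injective ℝ ha0
    change norm3 xav • a = (((N : ℝ) - 2 * M) / N) • a
    rw [← hxa, hav, hsum, smul_smul, div_eq_inv_mul]
  have hlt : 2 * M < N := by
    have h := hnorm ▸ hr
    rw [div_pos_iff_of_pos_right hNpos] at h
    exact_mod_cast sub_pos.mp h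
  have hle : 2 * (M : ℝ) + 1 ≤ N := by exact_mod_cast hlt
  refine ⟨by linarith, hnorm, ?_⟩
  rw [hnorm]
  gcongr
  linarith
end
end

section
/- Let N ≥ 1 and let x_1, …, x_N : [0, ∞) → ℝ³ be C¹ functions with ‖x_k(0)‖ = 1 for all k, satisfying the closed-loop dynamics ẋ_k = (x_k × x_av) × x_k for all t ≥ 0, where x_av(t) = (1/N) ∑_{j=1}^N x_j(t). Then ‖x_k(t)‖ = 1 for all t ≥ 0, and for each k, x_k(t) × x_av(t) → 0 as t → ∞; that is, every solution asymptotically converges to the set where each velocity vector is parallel to the average velocity. -/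
open Filter

noncomputable section

open Topology Set

lemma norm3_eq_one_iff (v : Fin 3 → ℝ) : norm3 v = 1 ↔ ∑ i, v i ^ 2 = 1 := by
  rw [norm3, Real.sqrt_eq_one]

lemma continuous_cross3 {X : Type*} [TopologicalSpace X] {f g : X → Fin 3 → ℝ}
    (hf : Continuous f) (hg : Continuous g) : Continuous fun p => cross3 (f p) (g p) := by
  refine continuous_pi fun i => ?_
  fin_cases i <;> simp only [cross3, cross_apply] <;> simp <;> fun_prop

lemma sum_mul_cross3_cross3_self (u v : Fin 3 → ℝ) :
    ∑ i, u i * cross3 (cross3 u v) u i = 0 := by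
  simp only [cross3, cross_apply, Fin.sum_univ_three]
  simp
  ring

lemma sum_mul_cross3_cross3 (u v : Fin 3 → ℝ) :
    ∑ i, v i * cross3 (cross3 u v) u i = ∑ i, cross3 u v i ^ 2 := by
  simp only [cross3, cross_apply, Fin.sum_univ_three]
  simp
  ring

/-- **Barbalat's lemma** for a bounded function with nonnegative uniformly continuous derivative. -/
lemma tendsto_zero_of_hasDerivAt_of_uniformContinuousOn {F f : ℝ → ℝ} {B : ℝ}
    (hF : ∀ t, 0 ≤ t → HasDerivAt F (f t) t) (hB : ∀ t, 0 ≤ t → F t ≤ B)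
    (hf : ∀ t, 0 ≤ t → 0 ≤ f t) (hu : UniformContinuousOn f (Ici 0)) :
    Tendsto f atTop (𝓝 0) := by
  have hmono : MonotoneOn F (Ici 0) := by
    refine monotoneOn_of_hasDerivWithinAt_nonneg (f' := f) (convex_Ici 0)
      (fun t ht => (hF t ht).continuousAt.continuousWithinAt) ?_ ?_
    · intro t ht
      rw [interior_Ici] at ht
      exact (hF t (le_of_lt ht)).hasDerivWithinAt
    · intro t ht
      rw [interior_Ici] at ht
      exact hf t (le_of_lt ht)
  obtain ⟨l, hl⟩ : ∃ l, Tendsto F atTop (𝓝 l) := by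
    have hG : Monotone fun t => F (max t 0) := fun s t hst =>
      hmono (mem_Ici.2 (le_max_right s 0)) (mem_Ici.2 (le_max_right t 0)) (max_le_max_right 0 hst)
    refine ⟨_, (tendsto_atTop_ciSup hG ⟨B, ?_⟩).congr' ?_⟩
    · rintro _ ⟨t, rfl⟩
      exact hB _ (le_max_right _ _)
    · filter_upwards [eventually_ge_atTop 0] with t ht
      rw [max_eq_left ht]
  rw [Metric.tendsto_atTop]
  intro ε hε
  obtain ⟨δ, hδ, hδf⟩ := Metric.uniformContinuousOn_iff.1 hu (ε / 2) (half_pos hε)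
  have hh : 0 < δ / 2 := half_pos hδ
  have hdiff : Tendsto (fun t => F (t + δ / 2) - F t) atTop (𝓝 0) := by
    simpa using (hl.comp (tendsto_atTop_add_const_right atTop (δ / 2) tendsto_id)).sub hl
  obtain ⟨T, hT⟩ := eventually_atTop.1
    (hdiff.eventually_lt_const (show 0 < ε / 2 * (δ / 2) by positivity))
  refine ⟨max T 0, fun t ht => ?_⟩
  have ht0 : 0 ≤ t := (le_max_right _ _).trans ht
  obtain ⟨c, hc, hcF⟩ := exists_hasDerivAt_eq_slope F f (show t < t + δ / 2 by linarith)
    (fun s hs => (hF s (ht0.trans hs.1)).continuousAt.continuousWithinAt)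
    (fun s hs => hF s (ht0.trans hs.1.le))
  have hfc : f c < ε / 2 := by
    rw [hcF, add_sub_cancel_left, div_lt_iff₀ hh]
    exact hT t ((le_max_left _ _).trans ht)
  have hclose := hδf t ht0 c (ht0.trans hc.1.le) (by
    rw [Real.dist_eq, abs_lt]
    constructor <;> linarith [hc.1, hc.2])
  rw [Real.dist_eq, abs_lt] at hclose
  rw [Real.dist_eq, sub_zero, abs_of_nonneg (hf t ht0)]
  linarith [hclose.2]

/-- Along a trajectory of a continuous vector field that stays in a compact set, the nonnegative
rate of growth of a continuous Lyapunov function tends to zero. -/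
lemma tendsto_lyapunov_rate_zero {E : Type*} [NormedAddCommGroup E] [NormedSpace ℝ E]
    {K : Set E} (hK : IsCompact K) {G : E → E} (hG : Continuous G) {V φ : E → ℝ}
    (hV : Continuous V) (hφ : Continuous φ) (hφ0 : ∀ p, 0 ≤ φ p) {X : ℝ → E}
    (hXK : ∀ t, 0 ≤ t → X t ∈ K) (hX : ∀ t, 0 ≤ t → HasDerivAt X (G (X t)) t)
    (hVX : ∀ t, 0 ≤ t → HasDerivAt (fun s => V (X s)) (φ (X t)) t) :
    Tendsto (fun t => φ (X t)) atTop (𝓝 0) := by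
  obtain ⟨B, hB⟩ := hK.bddAbove_image hV.continuousOn
  obtain ⟨C, hC⟩ := hK.exists_bound_of_continuousOn hG.continuousOn
  have hlip : LipschitzOnWith C.toNNReal X (Ici 0) :=
    (convex_Ici 0).lipschitzOnWith_of_nnnorm_hasDerivWithin_le
      (fun t ht => (hX t ht).hasDerivWithinAt)
      (fun t ht => NNReal.coe_le_coe.1 ((hC _ (hXK t ht)).trans (Real.le_coe_toNNReal C)))
  exact tendsto_zero_of_hasDerivAt_of_uniformContinuousOn hVX
    (fun t ht => hB (mem_image_of_mem V (hXK t ht))) (fun t _ => hφ0 _)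
    ((hK.uniformContinuousOn_of_continuous hφ.continuousOn).comp hlip.uniformContinuousOn hXK)

/-- Squared speed is conserved by `ẋ = (x × a) × x`. -/
lemma norm3_eq_one_of_hasDerivAt {x a : ℝ → Fin 3 → ℝ} (hinit : norm3 (x 0) = 1)
    (hdyn : ∀ t, 0 ≤ t → HasDerivAt x (cross3 (cross3 (x t) (a t)) (x t)) t)
    {t : ℝ} (ht : 0 ≤ t) : norm3 (x t) = 1 := by
  have hder : ∀ s, 0 ≤ s → HasDerivAt (fun s => ∑ i, x s i ^ 2) 0 s := by
    intro s hs
    have h := HasDerivAt.fun_sum (u := Finset.univ)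
      fun i _ => (hasDerivAt_pi.1 (hdyn s hs) i).fun_pow 2
    refine h.congr_deriv ?_
    rw [← mul_zero 2, ← sum_mul_cross3_cross3_self (x s) (a s), Finset.mul_sum]
    exact Finset.sum_congr rfl fun i _ => by simp; ring
  rw [norm3_eq_one_iff] at hinit ⊢
  rw [← hinit]
  exact constant_of_has_deriv_right_zero
    (fun s hs => (hder s hs.1).continuousAt.continuousWithinAt)
    (fun s hs => (hder s hs.1).hasDerivWithinAt) t ⟨ht, le_rfl⟩

lemma norm_le_one_of_norm3_eq_one {v : Fin 3 → ℝ} (hv : norm3 v = 1) : ‖v‖ ≤ 1 := by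
  rw [norm3_eq_one_iff] at hv
  refine (pi_norm_le_iff_of_nonneg zero_le_one).2 fun i => ?_
  rw [Real.norm_eq_abs, ← sq_le_one_iff_abs_le_one, ← hv]
  exact Finset.single_le_sum (f := fun i => v i ^ 2) (fun j _ => sq_nonneg _) (Finset.mem_univ i)

/-- The potential `‖∑ j, x_j‖² / 2` grows at the rate `N * ∑ k, ‖x_k × x_av‖²`. -/
lemma hasDerivAt_potential {N : ℕ} (hN : 1 ≤ N) {x : Fin N → ℝ → Fin 3 → ℝ}
    {a : Fin 3 → ℝ} {t : ℝ} (ha : a = (N : ℝ)⁻¹ • ∑ j, x j t)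
    (hdyn : ∀ k, HasDerivAt (x k) (cross3 (cross3 (x k t) a) (x k t)) t) :
    HasDerivAt (fun s => ∑ i, (∑ j, x j s i) ^ 2 / 2)
      (N * ∑ k, ∑ i, cross3 (x k t) a i ^ 2) t := by
  have hN0 : (N : ℝ) ≠ 0 := by positivity
  have hsum : ∀ i, ∑ j, x j t i = N * a i := fun i => by
    simp [ha, hN0]
  have h := HasDerivAt.fun_sum (u := Finset.univ) fun (i : Fin 3) _ =>
    ((HasDerivAt.fun_sum (u := Finset.univ) fun (j : Fin N) _ =>
      hasDerivAt_pi.1 (hdyn j) i).fun_pow 2).div_const 2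
  refine h.congr_deriv ?_
  simp only [← sum_mul_cross3_cross3, hsum]
  rw [Finset.sum_comm, Finset.mul_sum]
  refine Finset.sum_congr rfl fun i _ => ?_
  rw [← Finset.mul_sum]
  simp
  ring

/-- Along the closed-loop parallel-formation dynamics
`ẋ_k = (x_k × x_av) × x_k` on `[0, ∞)` with unit initial speeds, the speeds remain unitary and
`x_k(t) × x_av(t) → 0` as `t → ∞`: every solution converges to the set where each velocity
vector is parallel to the average velocity. -/
theorem parallel_formation_convergence_to_critical_set
    (N : ℕ) (hN : 1 ≤ N)
    (x : Fin N → ℝ → Fin 3 → ℝ)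
    (xav : ℝ → Fin 3 → ℝ)
    (hav : ∀ t, xav t = (N : ℝ)⁻¹ • ∑ j, x j t)
    (hinit : ∀ k, norm3 (x k 0) = 1)
    (hdyn : ∀ k, ∀ t : ℝ, 0 ≤ t →
      HasDerivAt (x k) (cross3 (cross3 (x k t) (xav t)) (x k t)) t) :
    (∀ k, ∀ t : ℝ, 0 ≤ t → norm3 (x k t) = 1) ∧
    (∀ k, Tendsto (fun t => cross3 (x k t) (xav t)) atTop (nhds 0)) := by
  have hunit : ∀ k, ∀ t : ℝ, 0 ≤ t → norm3 (x k t) = 1 := fun k t ht =>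
    norm3_eq_one_of_hasDerivAt (hinit k) (hdyn k) ht
  refine ⟨hunit, fun k => ?_⟩
  let avg : (Fin N → Fin 3 → ℝ) → Fin 3 → ℝ := fun p => (N : ℝ)⁻¹ • ∑ j, p j
  have havg : Continuous avg := by fun_prop
  have hcross : ∀ k, Continuous fun p : Fin N → Fin 3 → ℝ => cross3 (p k) (avg p) := fun k =>
    continuous_cross3 (continuous_apply k) havg
  have hrate : Tendsto (fun t => N * ∑ k, ∑ i, cross3 (x k t) (avg fun j => x j t) i ^ 2)
      atTop (𝓝 0) := by
    refine tendsto_lyapunov_rate_zero (X := fun t j => x j t)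
      (G := fun p k => cross3 (cross3 (p k) (avg p)) (p k))
      (V := fun p => ∑ i, (∑ j, p j i) ^ 2 / 2)
      (φ := fun p => N * ∑ k, ∑ i, cross3 (p k) (avg p) i ^ 2)
      (isCompact_closedBall 0 1) ?_ (by fun_prop) ?_ (fun p => by positivity) ?_ ?_ ?_
    · exact continuous_pi fun k => continuous_cross3 (hcross k) (continuous_apply k)
    · exact continuous_const.mul (continuous_finsetSum _ fun k _ => continuous_finsetSum _
        fun i _ => ((continuous_apply i).comp (hcross k)).pow 2)
    · intro t ht
      rw [mem_closedBall_zero_iff]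
      exact (pi_norm_le_iff_of_nonneg zero_le_one).2 fun j =>
        norm_le_one_of_norm3_eq_one (hunit j t ht)
    · intro t ht
      refine hasDerivAt_pi.2 fun j => ?_
      simpa only [hav t] using hdyn j t ht
    · intro t ht
      exact hasDerivAt_potential hN rfl fun j => by simpa only [hav t] using hdyn j t ht
  refine tendsto_pi_nhds.2 fun i => squeeze_zero_norm (fun t => ?_)
    (Real.sqrt_zero ▸ hrate.sqrt)
  rw [Real.norm_eq_abs]
  refine Real.abs_le_sqrt ?_
  rw [hav t]
  have hN1 : (1 : ℝ) ≤ N := by exact_mod_cast hN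
  calc cross3 (x k t) (avg fun j => x j t) i ^ 2
      ≤ ∑ i, cross3 (x k t) (avg fun j => x j t) i ^ 2 :=
        Finset.single_le_sum (f := fun i => cross3 (x k t) (avg fun j => x j t) i ^ 2)
          (fun _ _ => sq_nonneg _) (Finset.mem_univ i)
    _ ≤ ∑ k, ∑ i, cross3 (x k t) (avg fun j => x j t) i ^ 2 :=
        Finset.single_le_sum (f := fun k => ∑ i, cross3 (x k t) (avg fun j => x j t) i ^ 2)
          (fun _ _ => by positivity) (Finset.mem_univ k)
    _ ≤ N * ∑ k, ∑ i, cross3 (x k t) (avg fun j => x j t) i ^ 2 :=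
        le_mul_of_one_le_left (by positivity) hN1
end
end
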